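/- Let p ≥ 0, let e_1 and e_2 be even integers with 0 ≤ e_1 < e_2, and let o_1 ≤ o_2 ≤ … ≤ o_{2p} be odd positive integers with e_1 ≤ o_1 and o_{2p} ≤ e_2 (these last two conditions being vacuous when p = 0). Let λ be the partition with parts e_2, o_{2p}, …, o_1, e_1 (the part e_1 being omitted when e_1 = 0). Then the D-collapse λ_D equals the partition with parts e_2 − 1, o_{2p}, …, o_1, e_1 + 1. -/

import Mathlib

namespace WFPaper

/-- The list of parts of a partition (multiset of positive integers) in weakly
decreasing order. -/
def sortedDesc (s : Multiset ℕ) : List ℕ := (s.sort (· ≤ ·)).reverse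

/-- The `j`-th largest part of `s` (1-indexed); `0` if `j = 0` or `j > #s`. -/
def part (s : Multiset ℕ) (j : ℕ) : ℕ := (sortedDesc s).getD (j - 1) 0

/-- The smallest part of `s` (`0` if `s` is empty). -/
def minPart (s : Multiset ℕ) : ℕ := (s.sort (· ≤ ·)).getD 0 0

/-- Sum of the `j` largest parts of `s`. -/
def psum (s : Multiset ℕ) (j : ℕ) : ℕ := ((sortedDesc s).take j).sum

/-- Dominance order: `DomLE a b` means `a ≤ b` in the dominance order, i.e.
for every `j` the sum of the `j` largest parts of `a` is at most that of `b`. -/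
def DomLE (a b : Multiset ℕ) : Prop := ∀ j, psum a j ≤ psum b j

/-- All parts are positive. -/
def PosParts (s : Multiset ℕ) : Prop := ∀ x ∈ s, 0 < x

/-- A partition of an odd number in which every even part has even multiplicity
(a B-partition of `n` when the sum is `2*n+1`). -/
def IsTypeB (s : Multiset ℕ) : Prop :=
  PosParts s ∧ Odd s.sum ∧ ∀ x, Even x → Even (s.count x)

/-- A partition of an even number in which every odd part has even multiplicity
(a C-partition of `n` when the sum is `2*n`). -/
def IsTypeC (s : Multiset ℕ) : Prop :=
  PosParts s ∧ Even s.sum ∧ ∀ x, Odd x → Even (s.count x)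

/-- A partition of an even number in which every even part has even multiplicity
(a D-partition of `n` when the sum is `2*n`). -/
def IsTypeD (s : Multiset ℕ) : Prop :=
  PosParts s ∧ Even s.sum ∧ ∀ x, Even x → Even (s.count x)

/-- `IsCollapse T α β` : `β` is the dominance-largest partition of class `T` of
the same number as `α` which is dominated by `α` (e.g. the B/C/D-collapse of `α`
for `T = IsTypeB/IsTypeC/IsTypeD`). -/
def IsCollapse (T : Multiset ℕ → Prop) (α β : Multiset ℕ) : Prop :=
  T β ∧ β.sum = α.sum ∧ DomLE β α ∧
    ∀ γ, T γ → γ.sum = α.sum → DomLE γ α → DomLE γ β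

/-- The transpose (conjugate) partition: its `j`-th part (0-indexed `j`) is the
number of parts of `s` that are `≥ j+1`. -/
def transpose (s : Multiset ℕ) : Multiset ℕ :=
  (Multiset.range (part s 1)).map (fun j => (s.filter (fun x => j + 1 ≤ x)).card)

/-- `λ⁻` : subtract 1 from the smallest part (the part being deleted if it
becomes 0). -/
def decMin (s : Multiset ℕ) : Multiset ℕ :=
  ((minPart s - 1) ::ₘ s.erase (minPart s)).filter (fun x => 0 < x)

/-- `λ⁺` : add 1 to the largest part. -/
def incMax (s : Multiset ℕ) : Multiset ℕ :=
  (part s 1 + 1) ::ₘ s.erase (part s 1)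

/-- The subpartition `μ` of `T` whose multiplicity at an even `x` is 2 if
`m_T(x)` is even and nonzero, 1 if `m_T(x)` is odd, and 0 at odd `x`. -/
def muEven (T : Multiset ℕ) : Multiset ℕ :=
  (T.toFinset.filter (fun x => Even x)).val.bind
    (fun x => Multiset.replicate (if Even (T.count x) then 2 else 1) x)

/-- The subpartition `μ` of `T` whose multiplicity at an odd `x` is 2 if
`m_T(x)` is even and nonzero, 1 if `m_T(x)` is odd, and 0 at even `x`. -/
def muOdd (T : Multiset ℕ) : Multiset ℕ :=
  (T.toFinset.filter (fun x => Odd x)).val.bind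
    (fun x => Multiset.replicate (if Even (T.count x) then 2 else 1) x)

/-- The subpartition `π` of `T` consisting of the even parts of `T` of odd
multiplicity, each taken once. -/
def piEven (T : Multiset ℕ) : Multiset ℕ :=
  (T.toFinset.filter (fun x => Even x ∧ Odd (T.count x))).val

/-- `k` is a (1-indexed) position of an odd part of `s`. -/
def OddIdx (s : Multiset ℕ) (k : ℕ) : Prop := 1 ≤ k ∧ Odd (part s k)

/-- `k` is a (1-indexed) position of an even part of `s`. -/
def EvenIdx (s : Multiset ℕ) (k : ℕ) : Prop :=
  1 ≤ k ∧ k ≤ Multiset.card s ∧ Even (part s k)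

/-- `e_s(i,j)` : number of positions `i ≤ k ≤ j` with `s_k` even. -/
def eCount (s : Multiset ℕ) (i j : ℕ) : ℕ :=
  ((Finset.Icc i j).filter (fun k => Even (part s k))).card

/-- number of positions `i ≤ k ≤ j` with `s_k` odd. -/
def oCount (s : Multiset ℕ) (i j : ℕ) : ℕ :=
  ((Finset.Icc i j).filter (fun k => Odd (part s k))).card

/-- `s` is special in the e-count sense: `e_s(1,t₁)` is even, and
`e_s(tᵢ,tᵢ₊₁)` is even for all `1 ≤ i ≤ p-1`, where `t₁ < ⋯ < t_p` are the
positions of the odd parts of `s`. -/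
def IsSpecialE (s : Multiset ℕ) : Prop :=
  (∀ t, OddIdx s t → (∀ t', OddIdx s t' → t ≤ t') → Even (eCount s 1 t)) ∧
  (∀ i j, OddIdx s i → OddIdx s j → i < j →
    (∀ k, OddIdx s k → k ≤ i ∨ j ≤ k) → Even (eCount s i j))

/-- `s` is quasi-special: `e_s(1,t₁)` is even, `e_s(tᵢ,tᵢ₊₁)` is even for all
`1 ≤ i ≤ p-2`, and the smallest part of `s` is odd with multiplicity 1. -/
def IsQuasiSpecialE (s : Multiset ℕ) : Prop :=
  (∀ t, OddIdx s t → (∀ t', OddIdx s t' → t ≤ t') → Even (eCount s 1 t)) ∧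
  (∀ i j, OddIdx s i → OddIdx s j → i < j →
    (∀ k, OddIdx s k → k ≤ i ∨ j ≤ k) → (∃ k, OddIdx s k ∧ j < k) →
      Even (eCount s i j)) ∧
  Odd (minPart s) ∧ s.count (minPart s) = 1

/-- Number of odd parts greater than every even part (equals the number of odd
parts greater than the largest even part, and the number of all odd parts if
there are no even parts). -/
def numOddDominant (s : Multiset ℕ) : ℕ :=
  (s.filter (fun x => Odd x ∧ ∀ y ∈ s, Even y → y < x)).card

/-- Between every pair of consecutive even parts of `s` (in the decreasing
listing of the parts) there is an even number of odd parts. -/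
def EvenBetween (s : Multiset ℕ) : Prop :=
  ∀ i j, EvenIdx s i → EvenIdx s j → i < j →
    (∀ k, EvenIdx s k → k ≤ i ∨ j ≤ k) → Even (oCount s i j)

/-- A special B-partition. -/
def IsSpecialTypeB (s : Multiset ℕ) : Prop :=
  IsTypeB s ∧ EvenBetween s ∧ Odd (numOddDominant s)

/-- A special D-partition. -/
def IsSpecialTypeD (s : Multiset ℕ) : Prop :=
  IsTypeD s ∧ EvenBetween s ∧ Even (numOddDominant s)

theorem sortedDesc_pairwise (s : Multiset ℕ) : (sortedDesc s).Pairwise (· ≥ ·) := by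
  unfold sortedDesc
  rw [List.pairwise_reverse]
  exact Multiset.pairwise_sort s (· ≤ ·)

theorem coe_sortedDesc (s : Multiset ℕ) : (sortedDesc s : Multiset ℕ) = s := by
  unfold sortedDesc
  rw [Multiset.coe_reverse, Multiset.sort_eq]

theorem sortedDesc_coe {l : List ℕ} (hl : l.Pairwise (· ≥ ·)) :
    sortedDesc (l : Multiset ℕ) = l :=
  (Multiset.coe_eq_coe.1 (coe_sortedDesc (l : Multiset ℕ))).eq_of_pairwise
    (fun _ _ _ _ h₁ h₂ => le_antisymm h₂ h₁) (sortedDesc_pairwise _) hl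

theorem psum_succ (s : Multiset ℕ) (j : ℕ) :
    psum s (j + 1) = psum s j + (sortedDesc s).getD j 0 := by
  unfold psum
  rcases lt_or_ge j (sortedDesc s).length with h | h
  · rw [List.sum_take_succ _ _ h, List.getD_eq_getElem _ _ h]
  · rw [List.take_of_length_le h, List.take_of_length_le (by omega),
      List.getD_eq_default _ _ h, add_zero]

theorem getD_antitone {l : List ℕ} (hl : l.Pairwise (· ≥ ·)) {i j : ℕ} (hij : i < j) :
    l.getD j 0 ≤ l.getD i 0 := by
  rcases lt_or_ge j l.length with h | h
  · rw [List.getD_eq_getElem _ _ h, List.getD_eq_getElem _ _ (hij.trans h)]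
    exact List.pairwise_iff_getElem.1 hl i j _ _ hij
  · rw [List.getD_eq_default _ _ h]
    exact Nat.zero_le _

theorem eq_of_getD_eq {l₁ l₂ : List ℕ} (h₁ : ∀ x ∈ l₁, 0 < x) (h₂ : ∀ x ∈ l₂, 0 < x)
    (h : ∀ j, l₁.getD j 0 = l₂.getD j 0) : l₁ = l₂ := by
  induction l₁ generalizing l₂ with
  | nil =>
    cases l₂ with
    | nil => rfl
    | cons b t =>
      have h0 := h 0
      have hb := h₂ b (by simp)
      simp at h0
      omega
  | cons a s ih =>
    cases l₂ with
    | nil =>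
      have h0 := h 0
      have ha := h₁ a (by simp)
      simp at h0
      omega
    | cons b t =>
      have h0 : a = b := by simpa using h 0
      have hst : s = t := ih (fun x hx => h₁ x (by simp [hx]))
        (fun x hx => h₂ x (by simp [hx])) (fun j => by simpa using h (j + 1))
      rw [h0, hst]

theorem eq_of_psum_eq {s t : Multiset ℕ} (hs : PosParts s) (ht : PosParts t)
    (h : ∀ j, psum s j = psum t j) : s = t := by
  have hmem : ∀ {u : Multiset ℕ}, PosParts u → ∀ x ∈ sortedDesc u, 0 < x := by
    intro u hu x hx
    refine hu x ?_
    rw [← coe_sortedDesc u]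
    exact Multiset.mem_coe.2 hx
  rw [← coe_sortedDesc s, ← coe_sortedDesc t]
  congr 1
  refine eq_of_getD_eq (hmem hs) (hmem ht) fun j => ?_
  have h₁ := psum_succ s j
  have h₂ := psum_succ t j
  have h₃ := h j
  have h₄ := h (j + 1)
  omega

/-- An entry of a decreasing list differing from all earlier ones and larger than the next one
occurs exactly once. -/
theorem count_getD_eq_one {l : List ℕ} (hl : l.Pairwise (· ≥ ·)) {i : ℕ}
    (hbefore : ∀ k < i, l.getD k 0 ≠ l.getD i 0) (hafter : l.getD (i + 1) 0 < l.getD i 0) :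
    l.count (l.getD i 0) = 1 := by
  have hi : i < l.length := by
    by_contra hi
    rw [List.getD_eq_default l _ (not_lt.1 hi)] at hafter
    omega
  set x := l.getD i 0 with hx
  have hxi : l[i] = x := (List.getD_eq_getElem _ _ hi).symm
  have hsplit : l = l.take i ++ x :: l.drop (i + 1) := by
    rw [← hxi, ← List.drop_eq_getElem_cons hi, List.take_append_drop]
  have htake : (l.take i).count x = 0 := by
    rw [List.count_eq_zero]
    intro hmem
    obtain ⟨k, hk, hkx⟩ := List.mem_iff_getElem.1 hmem
    rw [List.getElem_take] at hkx
    have hk' : k < i := by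
      rw [List.length_take] at hk
      omega
    exact hbefore k hk' (by rw [List.getD_eq_getElem _ _ (hk'.trans hi), hkx])
  have hdrop : (l.drop (i + 1)).count x = 0 := by
    rw [List.count_eq_zero]
    intro hmem
    obtain ⟨k, hk, hkx⟩ := List.mem_iff_getElem.1 hmem
    rw [List.getElem_drop] at hkx
    rw [List.length_drop] at hk
    have hkl : i + 1 + k < l.length := by omega
    have hle : l.getD (i + 1 + k) 0 ≤ l.getD (i + 1) 0 := by
      rcases Nat.eq_zero_or_pos k with rfl | hk0
      · exact le_rfl
      · exact getD_antitone hl (by omega)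
    rw [List.getD_eq_getElem _ _ hkl, hkx] at hle
    omega
  rw [hsplit, List.count_append, List.count_cons_self, htake, hdrop]

/-- If `d`, whose even parts have even multiplicity, dominates a partition `m` into odd parts,
and its partial sums exceed those of `m` by at most one, and not at all from the number of parts
of `m` on, then `d = m`. -/
theorem eq_of_psum_le_add_one {d m : Multiset ℕ} (hdpos : PosParts d) (hmpos : PosParts m)
    (hd : ∀ x, Even x → Even (d.count x)) (hm : ∀ x ∈ m, Odd x)
    (hle : ∀ j, psum m j ≤ psum d j) (hle_add : ∀ j, psum d j ≤ psum m j + 1)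
    (hlast : ∀ j, Multiset.card m ≤ j → psum d j ≤ psum m j) : d = m := by
  refine eq_of_psum_eq hdpos hmpos ?_
  by_contra! hne
  classical
  obtain ⟨j, hj, hmin⟩ : ∃ j, psum d j ≠ psum m j ∧ ∀ k < j, psum d k = psum m k :=
    ⟨Nat.find hne, Nat.find_spec hne, fun k hk => not_not.1 (Nat.find_min hne hk)⟩
  obtain _ | i := j
  · exact hj (by simp [psum])
  have hlen : (sortedDesc m).length = Multiset.card m := by
    rw [← Multiset.coe_card, coe_sortedDesc]
  have hi : i + 1 < Multiset.card m := by
    by_contra hi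
    exact hj (le_antisymm (hlast _ (not_lt.1 hi)) (hle _))
  have hoddm : ∀ k ≤ i, Odd ((sortedDesc m).getD k 0) := by
    intro k hk
    have hk' : k < (sortedDesc m).length := by omega
    rw [List.getD_eq_getElem _ _ hk']
    refine hm _ ?_
    have hmem := Multiset.mem_coe.2 (List.getElem_mem hk')
    rwa [coe_sortedDesc] at hmem
  have hdi : (sortedDesc d).getD i 0 = (sortedDesc m).getD i 0 + 1 := by
    have h₁ := hmin i (by omega)
    have h₂ := psum_succ d i
    have h₃ := psum_succ m i
    have h₄ := hle (i + 1)
    have h₅ := hle_add (i + 1)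
    omega
  have heven : Even ((sortedDesc d).getD i 0) := by
    rw [hdi]
    exact (hoddm i le_rfl).add_one
  have hcount : (sortedDesc d).count ((sortedDesc d).getD i 0) = 1 := by
    refine count_getD_eq_one (sortedDesc_pairwise d) ?_ ?_
    · intro k hk heq
      have h₁ := hmin k (by omega)
      have h₂ := hmin (k + 1) (by omega)
      have h₃ := psum_succ d k
      have h₄ := psum_succ m k
      have h₅ : (sortedDesc d).getD k 0 = (sortedDesc m).getD k 0 := by omega
      have h₆ := hoddm k hk.le
      rw [← h₅, heq] at h₆
      exact Nat.not_odd_iff_even.2 heven h₆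
    · have h₁ := psum_succ d (i + 1)
      have h₂ := psum_succ m (i + 1)
      have h₃ := hle_add (i + 1 + 1)
      have h₄ := hle (i + 1)
      have h₅ := getD_antitone (sortedDesc_pairwise m) (Nat.lt_succ_self i)
      have h₆ := hle_add (i + 1)
      simp only [Nat.succ_eq_add_one] at h₅
      omega
  have hc := hd _ heven
  rw [← coe_sortedDesc d, Multiset.coe_count, coe_sortedDesc, hcount] at hc
  exact Nat.not_even_one hc

theorem pairwise_cons_append {a : ℕ} {l t : List ℕ} (hl : l.Pairwise (· ≥ ·))
    (ht : t.Pairwise (· ≥ ·)) (hal : ∀ x ∈ l, x ≤ a) (hat : ∀ y ∈ t, y ≤ a)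
    (hlt : ∀ x ∈ l, ∀ y ∈ t, y ≤ x) : (a :: (l ++ t)).Pairwise (· ≥ ·) := by
  rw [List.pairwise_cons, List.pairwise_append]
  refine ⟨fun x hx => ?_, hl, ht, hlt⟩
  rcases List.mem_append.1 hx with h | h
  exacts [hal x h, hat x h]

/-- For even `0 ≤ e₁ < e₂` and odd `o₁ ≤ ⋯ ≤ o_{2p}` with
`e₁ ≤ o₁`, `o_{2p} ≤ e₂`, the D-collapse of the partition with parts
`e₂, o_{2p}, …, o₁, e₁` (`e₁` omitted if zero) is the partition with parts
`e₂ - 1, o_{2p}, …, o₁, e₁ + 1`. -/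
theorem statement14 (p e1 e2 : ℕ) (he1 : Even e1) (he2 : Even e2) (h12 : e1 < e2)
    (o : ℕ → ℕ)
    (hodd : ∀ i, 1 ≤ i → i ≤ 2 * p → Odd (o i))
    (hmono : ∀ i j, 1 ≤ i → i ≤ j → j ≤ 2 * p → o i ≤ o j)
    (hlo : 0 < p → e1 ≤ o 1) (hhi : 0 < p → o (2 * p) ≤ e2)
    (lam : Multiset ℕ)
    (hlam : lam = (e2 ::ₘ (Multiset.range (2 * p)).map (fun i => o (i + 1))) +
      (if e1 = 0 then (0 : Multiset ℕ) else {e1}))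
    (d : Multiset ℕ) (hd : IsCollapse IsTypeD lam d) :
    d = ((e2 - 1) ::ₘ (Multiset.range (2 * p)).map (fun i => o (i + 1))) +
      ({e1 + 1} : Multiset ℕ) := by
  set l : List ℕ := ((List.range (2 * p)).map (fun i => o (i + 1))).reverse with hl
  have hlen : l.length = 2 * p := by simp [hl]
  have hcoe : (Multiset.range (2 * p)).map (fun i => o (i + 1)) = (l : Multiset ℕ) := by
    rw [hl, Multiset.coe_reverse, ← Multiset.map_coe, Multiset.coe_range]
  have hmem : ∀ x ∈ l, Odd x ∧ e1 ≤ x ∧ x ≤ e2 := by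
    intro x hx
    simp only [hl, List.mem_reverse, List.mem_map, List.mem_range] at hx
    obtain ⟨i, hi, rfl⟩ := hx
    exact ⟨hodd _ (by omega) (by omega),
      (hlo (by omega)).trans (hmono 1 (i + 1) le_rfl (by omega) (by omega)),
      (hmono (i + 1) (2 * p) (by omega) (by omega) le_rfl).trans (hhi (by omega))⟩
  have hsorted : l.Pairwise (· ≥ ·) := by
    rw [hl, List.pairwise_reverse, List.pairwise_map]
    refine List.Pairwise.imp_of_mem ?_ (List.pairwise_lt_range (n := 2 * p))
    intro i j _ hj hij
    rw [List.mem_range] at hj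
    exact hmono (i + 1) (j + 1) (by omega) (by omega) (by omega)
  set t : List ℕ := if e1 = 0 then [] else [e1] with ht
  have hmem_t : ∀ y ∈ t, y = e1 := by
    intro y hy
    rw [ht] at hy
    split_ifs at hy <;> simp_all
  have hlam' : lam = ((e2 :: (l ++ t) : List ℕ) : Multiset ℕ) := by
    rw [hlam, hcoe, ht]
    split_ifs
    · simp
    · rfl
  have htarget : ((e2 - 1) ::ₘ (Multiset.range (2 * p)).map (fun i => o (i + 1))) +
      ({e1 + 1} : Multiset ℕ) = (((e2 - 1) :: (l ++ [e1 + 1]) : List ℕ) : Multiset ℕ) := by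
    rw [hcoe]
    rfl
  rw [htarget]
  set m : Multiset ℕ := (((e2 - 1) :: (l ++ [e1 + 1]) : List ℕ) : Multiset ℕ) with hm
  obtain ⟨a, ha⟩ := he1
  obtain ⟨b, hb⟩ := he2
  have hlam_desc : sortedDesc lam = e2 :: (l ++ t) := by
    rw [hlam']
    refine sortedDesc_coe (pairwise_cons_append hsorted ?_ (fun x hx => (hmem x hx).2.2) ?_ ?_)
    · rw [ht]
      split_ifs <;> simp
    · intro y hy
      rw [hmem_t y hy]
      exact h12.le
    · intro x hx y hy
      rw [hmem_t y hy]
      exact (hmem x hx).2.1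
  have hm_desc : sortedDesc m = (e2 - 1) :: (l ++ [e1 + 1]) := by
    refine sortedDesc_coe (pairwise_cons_append hsorted (by simp) ?_ ?_ ?_)
    · intro x hx
      obtain ⟨⟨c, hc⟩, -, h⟩ := hmem x hx
      omega
    · intro y hy
      rw [List.mem_singleton] at hy
      omega
    · intro x hx y hy
      rw [List.mem_singleton] at hy
      obtain ⟨⟨c, hc⟩, h, -⟩ := hmem x hx
      omega
  have hlam_psum : ∀ j, psum lam (j + 1) =
      e2 + ((l.take j).sum + if j ≤ 2 * p then 0 else e1) := by
    intro j
    rw [psum, hlam_desc, List.take_succ_cons, List.sum_cons, List.take_append, List.sum_append,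
      hlen, ht]
    split_ifs with h0 hj hj
    · simp
    · simp [h0]
    · simp [Nat.sub_eq_zero_of_le hj]
    · rw [List.take_of_length_le (l := [e1]) (by simp; omega), List.sum_singleton]
  have hm_psum : ∀ j, psum m (j + 1) =
      e2 - 1 + ((l.take j).sum + if j ≤ 2 * p then 0 else e1 + 1) := by
    intro j
    rw [psum, hm_desc, List.take_succ_cons, List.sum_cons, List.take_append, List.sum_append,
      hlen]
    split_ifs with hj
    · simp [Nat.sub_eq_zero_of_le hj]
    · rw [List.take_of_length_le (l := [e1 + 1]) (by simp; omega), List.sum_singleton]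
  have hcard : Multiset.card m = 2 * p + 2 := by
    simp [hm, hlen]
  have hm_odd : ∀ x ∈ m, Odd x := by
    intro x hx
    rw [hm, Multiset.mem_coe, List.mem_cons, List.mem_append, List.mem_singleton] at hx
    rcases hx with rfl | hx | rfl
    · exact ⟨b - 1, by omega⟩
    · exact (hmem x hx).1
    · exact ⟨a, by omega⟩
  have hm_sum : m.sum = lam.sum := by
    have ht_sum : t.sum = e1 := by
      rw [ht]
      split_ifs with h0 <;> simp [h0]
    rw [hm, hlam', Multiset.sum_coe, Multiset.sum_coe, List.sum_cons, List.sum_cons,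
      List.sum_append, List.sum_append, List.sum_singleton, ht_sum]
    omega
  obtain ⟨⟨hdpos, hdeven, hdcount⟩, hdsum, hdle, hdmax⟩ := hd
  have hmpos : PosParts m := fun x hx => (hm_odd x hx).pos
  have hmD : IsTypeD m := by
    refine ⟨hmpos, by rwa [hm_sum, ← hdsum], fun x hx => ?_⟩
    rw [Multiset.count_eq_zero.2 fun h => Nat.not_odd_iff_even.2 hx (hm_odd x h)]
    exact Even.zero
  have hm_le : DomLE m lam := by
    rintro (_ | j)
    · simp [psum]
    · rw [hm_psum, hlam_psum]
      split_ifs <;> omega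
  refine eq_of_psum_le_add_one hdpos hmpos hdcount hm_odd (hdmax m hmD hm_sum hm_le) ?_ ?_
  · rintro (_ | j)
    · simp [psum]
    · have h := hdle (j + 1)
      rw [hlam_psum] at h
      rw [hm_psum]
      split_ifs at h ⊢ <;> omega
  · rintro (_ | j) hj
    · omega
    · have h := hdle (j + 1)
      rw [hlam_psum] at h
      rw [hm_psum]
      split_ifs at h ⊢ <;> omega

end WFPaper
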